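/- arXiv:1302.0881 — 2 statements merged into one kernel-verified Lean document; each statement's English description precedes it below -/
import Mathlib

section
/- Let k ≥ 1 and let P₁ be a real polynomial of degree k+1; let a ∉ {0,−1} and N be real, and set P₂(x) = P₁(x−1−a) − P₁(x), a polynomial of degree k. Assume P₂(−n(1+a)) ≠ 0 for all n ≥ 0. Define γ_{n+1} = P₂(−n(1+a)) for n ≥ 0, λ_n = P₁(−n(1+a)) for n ≥ 0, β_n = (1/(1+a))·γ_{n+1}/γ_n for n ≥ 1, and the polynomials q_0 = 1 and q_n(x) = k_n^{a,N}(x) + β_n·k_{n−1}^{a,N}(x) for n ≥ 1. Let D = P₁(D_{a,N}) + (1/(1+a))·∇ ∘ P₂(D_{a,N}). Then D(q_n) = λ_n·q_n for all n ≥ 0. -/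
open Polynomial

/-- The Pochhammer symbol `(y)_j = y(y+1)⋯(y+j-1)` for a real `y`. -/
noncomputable def poch (y : ℝ) (j : ℕ) : ℝ := ∏ i ∈ Finset.range j, (y + i)

/-- The Krawtchouk polynomial
`k_n^{a,N}(x) = (1/n!) ∑_{j=0}^n (-1)^{n+j} ((1+a)/a)^{j-n} (-n)_j (-x)_j (N-n)_{n-j} / j!`. -/
noncomputable def krawtchouk (a N : ℝ) (n : ℕ) : ℝ[X] :=
  C ((n.factorial : ℝ))⁻¹ * ∑ j ∈ Finset.range (n+1),
    C ((-1:ℝ)^(n+j) * (a/(1+a))^(n-j) * poch (-(n : ℝ)) j * poch (N - n) (n-j)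
        / (j.factorial : ℝ)) * ∏ i ∈ Finset.range j, (-X + C (i : ℝ))

/-- A polynomial in `T` acts on an eigenvector of `T` by the value at the eigenvalue. -/
theorem aeval_apply_of_apply_eq_smul {R M : Type*} [CommRing R] [AddCommGroup M] [Module R M]
    {T : Module.End R M} {v : M} {μ : R} (h : T v = μ • v) (p : R[X]) :
    aeval T p v = p.eval μ • v := by
  induction p using Polynomial.induction_on' with
  | add p q hp hq => simp [hp, hq, add_smul]
  | monomial n c =>
    have hpow : (T ^ n) v = μ ^ n • v := by
      induction n with
      | zero => simp
      | succ n ih => rw [pow_succ', Module.End.mul_apply, ih, map_smul, h, smul_smul, pow_succ]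
    simp [aeval_monomial, hpow, smul_smul, mul_comm]

theorem succ_mul_ringChoose_succ (r : ℝ) (k : ℕ) :
    ((k : ℝ) + 1) * Ring.choose r (k + 1) = (r - k) * Ring.choose r k := by
  have h (m : ℕ) : (descPochhammer ℝ m).eval r = m.factorial * Ring.choose r m := by
    have := Ring.descPochhammer_eq_factorial_smul_choose r m
    rw [nsmul_eq_mul] at this
    rw [← this, ← descPochhammer_map (algebraMap ℤ ℝ), eval_map_algebraMap, aeval_eq_smeval]
  have h1 := descPochhammer_succ_eval k r
  rw [h, h, Nat.factorial_succ] at h1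
  have : (k.factorial : ℝ) ≠ 0 := by positivity
  apply mul_left_cancel₀ this
  push_cast at h1
  linear_combination h1

theorem succ_mul_ringChoose_succ_left (r : ℝ) (k : ℕ) :
    ((k : ℝ) + 1) * Ring.choose r (k + 1) = r * Ring.choose (r - 1) k := by
  have h1 := Ring.choose_succ_succ (r - 1) k
  rw [sub_add_cancel] at h1
  linear_combination ((k : ℝ) + 1) * h1 + succ_mul_ringChoose_succ (r - 1) k

theorem poch_eq_ringChoose (y : ℝ) (k : ℕ) :
    poch y k = k.factorial * Ring.choose (y + k - 1) k := by
  induction k with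
  | zero => simp [poch]
  | succ k ih =>
    have h := succ_mul_ringChoose_succ_left (y + k) k
    rw [poch, Finset.prod_range_succ, ← poch, ih, Nat.factorial_succ]
    push_cast
    rw [← add_assoc, add_sub_cancel_right]
    linear_combination -(k.factorial : ℝ) * h

theorem poch_neg (y : ℝ) (k : ℕ) :
    poch (-y) k = (-1) ^ k * (k.factorial * Ring.choose y k) := by
  induction k with
  | zero => simp [poch]
  | succ k ih =>
    have h := succ_mul_ringChoose_succ y k
    rw [poch, Finset.prod_range_succ, ← poch, ih, Nat.factorial_succ, pow_succ]
    push_cast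
    linear_combination (-1) ^ k * (k.factorial : ℝ) * h

theorem krawtchouk_eval (a N : ℝ) (n : ℕ) (x : ℝ) :
    (krawtchouk a N n).eval x = ∑ j ∈ Finset.range (n + 1),
      (-(a / (1 + a))) ^ (n - j) * Ring.choose (N - 1 - j) (n - j) * Ring.choose x j := by
  simp only [krawtchouk, eval_mul, eval_C, eval_finsetSum, eval_prod, eval_add, eval_neg, eval_X,
    Finset.mul_sum]
  refine Finset.sum_congr rfl fun j hj => ?_
  obtain ⟨m, rfl⟩ := Nat.exists_eq_add_of_le (Nat.lt_succ_iff.mp (Finset.mem_range.mp hj))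
  have hx : ∏ i ∈ Finset.range j, (-x + (i : ℝ)) = poch (-x) j := rfl
  have hc : ((j.factorial : ℝ) * m.factorial) * Ring.choose ((j + m : ℕ) : ℝ) j
      = (j + m).factorial := by
    rw [Ring.choose_natCast, mul_comm]
    have := Nat.choose_mul_factorial_mul_factorial (Nat.le_add_right j m)
    rw [Nat.add_sub_cancel_left] at this
    rw [← this]; push_cast; ring
  have hs : N - ((j + m : ℕ) : ℝ) + m - 1 = N - 1 - j := by push_cast; ring
  rw [hx, poch_neg, poch_neg, poch_eq_ringChoose, Nat.add_sub_cancel_left, hs, ← hc, neg_pow]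
  have h1 : Ring.choose ((j + m : ℕ) : ℝ) j ≠ 0 := by
    rw [Ring.choose_natCast]
    exact_mod_cast (Nat.choose_pos (Nat.le_add_right j m)).ne'
  have h2 : (j.factorial : ℝ) ≠ 0 := by positivity
  have h3 : (m.factorial : ℝ) ≠ 0 := by positivity
  have h4 : ((-1 : ℝ) ^ j) ^ 2 = 1 := by rw [← pow_mul, mul_comm, pow_mul]; simp
  have h5 : (-1 : ℝ) ^ (j + m + j) = (-1) ^ m := by
    rw [pow_add, pow_add]; linear_combination (-1) ^ m * h4
  rw [h5]
  generalize Ring.choose ((j + m : ℕ) : ℝ) j = c at *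
  field_simp
  linear_combination (-1) ^ m * (a / (1 + a)) ^ m * Ring.choose (N - 1 - j) m *
    Ring.choose x j * h4

theorem krawtchouk_zero (a N : ℝ) : krawtchouk a N 0 = 1 := by
  simp [krawtchouk, poch]

theorem krawtchouk_eval_forward_diff (a N : ℝ) (n : ℕ) (x : ℝ) :
    (krawtchouk a N (n + 1)).eval (x + 1) - (krawtchouk a N (n + 1)).eval x =
      (krawtchouk a N n).eval x + a / (1 + a) *
        ((krawtchouk a N n).eval (x + 1) - (krawtchouk a N n).eval x) := by
  have hd (m : ℕ) (c : ℕ → ℝ) :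
      ∑ j ∈ Finset.range (m + 1), c j * Ring.choose (x + 1) j -
        ∑ j ∈ Finset.range (m + 1), c j * Ring.choose x j =
      ∑ j ∈ Finset.range m, c (j + 1) * Ring.choose x j := by
    rw [Finset.sum_range_succ', Finset.sum_range_succ', Ring.choose_zero_right,
      Ring.choose_zero_right, add_sub_add_right_eq_sub, ← Finset.sum_sub_distrib]
    refine Finset.sum_congr rfl fun j _ => ?_
    rw [Ring.choose_succ_succ]
    ring
  simp only [krawtchouk_eval]
  rw [hd, hd, Finset.sum_range_succ, Finset.sum_range_succ (n := n), Finset.mul_sum,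
    add_right_comm, ← Finset.sum_add_distrib]
  congr 1
  · refine Finset.sum_congr rfl fun j hj => ?_
    obtain ⟨m, rfl⟩ := Nat.exists_eq_add_of_lt (Finset.mem_range.mp hj)
    have e1 : j + m + 1 + 1 - (j + 1) = m + 1 := by omega
    have e2 : j + m + 1 - j = m + 1 := by omega
    have e3 : j + m + 1 - (j + 1) = m := by omega
    have hN : N - 1 - (j : ℝ) = N - 1 - ((j + 1 : ℕ) : ℝ) + 1 := by push_cast; ring
    rw [e1, e2, e3, hN, Ring.choose_succ_succ, pow_succ]
    ring
  · simp

theorem krawtchouk_eval_difference_equation (a N : ℝ) (ha : 1 + a ≠ 0) (n : ℕ) (x : ℝ) :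
    x * (krawtchouk a N n).eval (x - 1) - (x - a * (x - N + 1)) * (krawtchouk a N n).eval x
      - a * (x - N + 1) * (krawtchouk a N n).eval (x + 1) =
    -(n : ℝ) * (1 + a) * (krawtchouk a N n).eval x := by
  have hop (m : ℕ) (c : ℕ → ℝ) :
      x * ∑ j ∈ Finset.range (m + 1), c j * Ring.choose (x - 1) j
        - (x - a * (x - N + 1)) * ∑ j ∈ Finset.range (m + 1), c j * Ring.choose x j
        - a * (x - N + 1) * ∑ j ∈ Finset.range (m + 1), c j * Ring.choose (x + 1) j =
      ∑ j ∈ Finset.range (m + 1), c j * (-(j : ℝ) * (1 + a)) * Ring.choose x j +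
      ∑ j ∈ Finset.range m, c (j + 1) * (a * (N - 1 - j)) * Ring.choose x j := by
    rw [Finset.sum_range_succ', Finset.sum_range_succ', Finset.sum_range_succ',
      Finset.sum_range_succ']
    simp only [Ring.choose_zero_right]
    have hsum : x * ∑ j ∈ Finset.range m, c (j + 1) * Ring.choose (x - 1) (j + 1)
        - (x - a * (x - N + 1)) * ∑ j ∈ Finset.range m, c (j + 1) * Ring.choose x (j + 1)
        - a * (x - N + 1) * ∑ j ∈ Finset.range m, c (j + 1) * Ring.choose (x + 1) (j + 1) =
        ∑ j ∈ Finset.range m, c (j + 1) * (-((j + 1 : ℕ) : ℝ) * (1 + a)) * Ring.choose x (j + 1) +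
        ∑ j ∈ Finset.range m, c (j + 1) * (a * (N - 1 - j)) * Ring.choose x j := by
      simp only [Finset.mul_sum]
      rw [← Finset.sum_sub_distrib, ← Finset.sum_sub_distrib, ← Finset.sum_add_distrib]
      refine Finset.sum_congr rfl fun j _ => ?_
      have h1 := Ring.choose_succ_succ (x - 1) j
      rw [sub_add_cancel] at h1
      have h2 := succ_mul_ringChoose_succ_left x j
      have h3 := succ_mul_ringChoose_succ x j
      rw [Ring.choose_succ_succ]
      push_cast
      linear_combination c (j + 1) * (-x * h1 + h2 + a * h3)
    rw [Nat.cast_zero]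
    linear_combination hsum
  simp only [krawtchouk_eval]
  rw [hop, Finset.sum_range_succ, Finset.sum_range_succ (n := n), add_right_comm,
    ← Finset.sum_add_distrib, mul_add (-(n : ℝ) * (1 + a)), Finset.mul_sum]
  congr 1
  · refine Finset.sum_congr rfl fun j hj => ?_
    obtain ⟨m, rfl⟩ := Nat.exists_eq_add_of_lt (Finset.mem_range.mp hj)
    have e2 : j + m + 1 - j = m + 1 := by omega
    have e3 : j + m + 1 - (j + 1) = m := by omega
    have hN : N - 1 - ((j + 1 : ℕ) : ℝ) = N - 1 - j - 1 := by push_cast; ring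
    have h := succ_mul_ringChoose_succ_left (N - 1 - j) m
    have hb : a / (1 + a) * (1 + a) = a := div_mul_cancel₀ a ha
    rw [e2, e3, hN, pow_succ]
    generalize a / (1 + a) = b at *
    push_cast
    linear_combination (-(-b) ^ m * Ring.choose x j * a) * h +
      (-(-b) ^ m * Ring.choose x j * ((m : ℝ) + 1) * Ring.choose (N - 1 - j) (m + 1)) * hb
  · ring

/-- Theorem 6.2: the polynomials `q_n = k_n^{a,N} + β_n k_{n-1}^{a,N}` are eigenfunctions
of `D = P₁(D_{a,N}) + (1/(1+a)) ∇ P₂(D_{a,N})`. -/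
theorem stmt14 (k : ℕ) (hk : 1 ≤ k)
    (a : ℝ) (ha0 : a ≠ 0) (ha1 : a ≠ -1) (N : ℝ)
    (P₁ P₂ : ℝ[X]) (hdegP₁ : P₁.degree = (k+1 : ℕ))
    (hP₂ : P₂ = P₁.comp (X - C (1+a)) - P₁)
    (hnz : ∀ n : ℕ, P₂.eval (-(n : ℝ) * (1+a)) ≠ 0)
    (γ lam β : ℕ → ℝ)
    (hγ : ∀ n : ℕ, γ (n+1) = P₂.eval (-(n : ℝ) * (1+a)))
    (hlam : ∀ n : ℕ, lam n = P₁.eval (-(n : ℝ) * (1+a)))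
    (hβ : ∀ n : ℕ, 1 ≤ n → β n = (1/(1+a)) * (γ (n+1) / γ n))
    (q : ℕ → ℝ[X]) (hq0 : q 0 = 1)
    (hq : ∀ n : ℕ, q (n+1) = krawtchouk a N (n+1) + C (β (n+1)) * krawtchouk a N n)
    (DaN : Module.End ℝ ℝ[X])
    (hDaN : ∀ f : ℝ[X], ∀ x : ℝ, (DaN f).eval x =
      x * f.eval (x-1) - (x - a*(x-N+1)) * f.eval x - a*(x-N+1) * f.eval (x+1))
    (nab : Module.End ℝ ℝ[X])
    (hnab : ∀ f : ℝ[X], ∀ x : ℝ, (nab f).eval x = f.eval x - f.eval (x-1))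
    (D : Module.End ℝ ℝ[X])
    (hD : D = aeval DaN P₁ + (1/(1+a)) • (nab * aeval DaN P₂)) :
    ∀ n : ℕ, D (q n) = lam n • q n := by
  have ha : 1 + a ≠ 0 := fun h => ha1 (by linarith)
  have hk_eig (n : ℕ) : DaN (krawtchouk a N n) = (-(n : ℝ) * (1 + a)) • krawtchouk a N n :=
    Polynomial.funext fun x => by
      rw [hDaN, krawtchouk_eval_difference_equation a N ha, eval_smul, smul_eq_mul]
  have hP₁k (n : ℕ) : aeval DaN P₁ (krawtchouk a N n) = lam n • krawtchouk a N n := by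
    rw [aeval_apply_of_apply_eq_smul (hk_eig n), hlam]
  have hP₂k (n : ℕ) : aeval DaN P₂ (krawtchouk a N n) = γ (n + 1) • krawtchouk a N n := by
    rw [aeval_apply_of_apply_eq_smul (hk_eig n), hγ]
  have hγlam (n : ℕ) : γ (n + 1) = lam (n + 1) - lam n := by
    rw [hγ, hlam, hlam, hP₂]
    simp only [eval_sub, eval_comp, eval_X, eval_C]
    congr 2
    push_cast
    ring
  intro n
  cases n with
  | zero =>
    have hnab1 : nab 1 = 0 := Polynomial.funext fun x => by simp [hnab]
    have h1 := hP₁k 0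
    have h2 := hP₂k 0
    rw [krawtchouk_zero] at h1 h2
    simp [hq0, hD, h1, h2, hnab1]
  | succ n =>
    have hβγ : β (n + 1) * γ (n + 1) = 1 / (1 + a) * γ (n + 2) := by
      have : γ (n + 1) ≠ 0 := by rw [hγ]; exact hnz n
      rw [hβ (n + 1) (Nat.le_add_left 1 n)]
      field_simp
    rw [hq, hD, ← smul_eq_C_mul]
    simp only [LinearMap.add_apply, LinearMap.smul_apply, Module.End.mul_apply, map_add, map_smul,
      hP₁k, hP₂k]
    refine Polynomial.funext fun x => ?_
    have hdiff := krawtchouk_eval_forward_diff a N n (x - 1)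
    rw [sub_add_cancel] at hdiff
    have hb : a / (1 + a) = 1 - 1 / (1 + a) := by field_simp; ring
    rw [hb] at hdiff
    simp only [eval_add, eval_smul, smul_eq_mul, hnab]
    rw [hγlam n] at hβγ ⊢
    generalize 1 / (1 + a) = s at *
    linear_combination (s * γ (n + 2)) * hdiff +
      (s * ((krawtchouk a N n).eval x - (krawtchouk a N n).eval (x - 1)) -
        (krawtchouk a N n).eval x) * hβγ
end

section
/- Let α, c, N be real numbers with α+c−N ∉ {−1,−2,−3,…} and such that 2m+α+c−N−1 ≠ 0 and 2m+α+c−N−2 ≠ 0 for every integer m ≥ 1. Put σ_m = 2m+α+c−N−2 for m ≥ 1. Then for every n ≥ 0 and all real x: (i) with ε_m = m(N−m)(m+α−N)/((2m+α+c−N−1)(2m+α+c−N−2)), one has −(σ_{n+1}/2)·h_n^{α,c,N}(x) + Σ_{j=1}^{n} (−1)^{j+1} σ_{n+1−j} · (∏_{i=0}^{j−1} ε_{n−i}) · h_{n−j}^{α,c,N}(x) = (−x+N−1)·(h_n^{α,c,N}(x+1) − h_n^{α,c,N}(x)) − ((α+c−N)/2)·h_n^{α,c,N}(x); and (ii) with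 ε′_m = m(m+α−N)(m+α+c−1)/((2m+α+c−N−1)(2m+α+c−N−2)) and σ′_m = −σ_m, one has −(σ′_{n+1}/2)·h_n^{α,c,N}(x) + Σ_{j=1}^{n} (−1)^{j+1} σ′_{n+1−j} · (∏_{i=0}^{j−1} ε′_{n−i}) · h_{n−j}^{α,c,N}(x) = (x−α)·(h_n^{α,c,N}(x) − h_n^{α,c,N}(x−1)) + ((α+c−N)/2)·h_n^{α,c,N}(x). -/
open Polynomial

/-- The monic Hahn polynomial
`h_n^{α,c,N}(x) = ∑_{j=0}^n (-n)_j (-x)_j (1-N+j)_{n-j} (c+j)_{n-j} / ((n+α+c-N+j)_{n-j} j!)`. -/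
noncomputable def hahn (α c N : ℝ) (n : ℕ) : ℝ[X] :=
  ∑ j ∈ Finset.range (n+1),
    C (poch (-(n : ℝ)) j * poch (1 - N + j) (n-j) * poch (c + j) (n-j)
        / (poch ((n : ℝ) + α + c - N + j) (n-j) * (j.factorial : ℝ)))
      * ∏ i ∈ Finset.range j, (-X + C (i : ℝ))

theorem poch_zero (y : ℝ) : poch y 0 = 1 := by simp [poch]

theorem poch_succ (y : ℝ) (j : ℕ) : poch y (j + 1) = poch y j * (y + j) := by
  simp [poch, Finset.prod_range_succ]

theorem poch_succ_left (y : ℝ) (j : ℕ) : poch y (j + 1) = y * poch (y + 1) j := by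
  simp only [poch, Finset.prod_range_succ', Nat.cast_zero, add_zero]
  rw [mul_comm]
  congr 1
  refine Finset.prod_congr rfl fun i _ => ?_
  push_cast
  ring

theorem poch_ne_zero {y : ℝ} {j : ℕ} (h : ∀ i : ℕ, y + i ≠ 0) : poch y j ≠ 0 :=
  Finset.prod_ne_zero_iff.mpr fun i _ => h i

theorem poch_neg_eq_zero {n j : ℕ} (h : n < j) : poch (-(n : ℝ)) j = 0 :=
  Finset.prod_eq_zero (Finset.mem_range.mpr h) (by simp)

/-- The coefficient of `(-x)_j` in `h_n^{α,c,N}(x)`; it vanishes for `n < j`. -/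
noncomputable def hahnCoeff (α c N : ℝ) (n j : ℕ) : ℝ :=
  poch (-(n : ℝ)) j * poch (1 - N + j) (n-j) * poch (c + j) (n-j)
    / (poch ((n : ℝ) + α + c - N + j) (n-j) * (j.factorial : ℝ))

theorem hahnCoeff_eq_zero (α c N : ℝ) {n j : ℕ} (h : n < j) : hahnCoeff α c N n j = 0 := by
  simp [hahnCoeff, poch_neg_eq_zero h]

theorem hahn_eval (α c N x : ℝ) {n M : ℕ} (h : n < M) :
    (hahn α c N n).eval x = ∑ j ∈ Finset.range M, hahnCoeff α c N n j * poch (-x) j := by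
  rw [← Finset.sum_subset (Finset.range_mono (Nat.succ_le_of_lt h))]
  · simp [hahn, eval_finsetSum, eval_prod, hahnCoeff, poch]
  · intro j _ hj
    rw [hahnCoeff_eq_zero _ _ _ (by simpa using hj), zero_mul]

theorem hahn_zero_eval (α c N x : ℝ) : (hahn α c N 0).eval x = 1 := by
  simp [hahn_eval α c N x Nat.zero_lt_one, hahnCoeff, poch]

theorem sum_range_mul_pred (a B f : ℕ → ℝ) {M : ℕ} (h : a M = 0) :
    ∑ j ∈ Finset.range M, a j * ((j : ℝ) * B j * f (j - 1))
      = ∑ j ∈ Finset.range M, ((j : ℝ) + 1) * B (j + 1) * a (j + 1) * f j := by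
  have h' := Finset.sum_range_succ (fun j => a j * ((j : ℝ) * B j * f (j - 1))) M
  rw [Finset.sum_range_succ'] at h'
  simp only [h, Nat.cast_zero, zero_mul, mul_zero, add_zero] at h'
  rw [← h']
  refine Finset.sum_congr rfl fun j _ => ?_
  push_cast
  ring

theorem poch_forward_diff (N s x : ℝ) (j : ℕ) :
    (-x + N - 1) * (poch (-(x + 1)) j - poch (-x) j) + s * poch (-x) j
      = (s - j) * poch (-x) j + j * (j - N) * poch (-x) (j - 1) := by
  cases j with
  | zero => simp [poch_zero]
  | succ j =>
    rw [poch_succ_left (-(x + 1)), poch_succ (-x), show -(x + 1) + 1 = -x by ring]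
    push_cast
    ring

theorem poch_backward_diff (α s x : ℝ) (j : ℕ) :
    (x - α) * (poch (-x) j - poch (-(x - 1)) j) + s * poch (-x) j
      = (s + j) * poch (1 - x) j + j * (α - j - s) * poch (1 - x) (j - 1) := by
  cases j with
  | zero => simp [poch_zero]
  | succ j =>
    rw [poch_succ_left (-x), show -(x - 1) = 1 - x by ring, show -x + 1 = 1 - x by ring,
      poch_succ (1 - x)]
    push_cast
    ring

theorem hahn_forward_diff (α c N s x : ℝ) {n M : ℕ} (h : n < M) :
    (-x + N - 1) * ((hahn α c N n).eval (x + 1) - (hahn α c N n).eval x)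
        + s * (hahn α c N n).eval x
      = ∑ j ∈ Finset.range M, ((s - j) * hahnCoeff α c N n j
          + ((j : ℝ) + 1) * (j + 1 - N) * hahnCoeff α c N n (j + 1)) * poch (-x) j := by
  have key := sum_range_mul_pred (hahnCoeff α c N n) (fun j => (j : ℝ) - N) (poch (-x))
    (hahnCoeff_eq_zero α c N h)
  simp only [Nat.cast_add, Nat.cast_one] at key
  simp only [add_mul _ _ (poch (-x) _), Finset.sum_add_distrib, ← key, hahn_eval α c N _ h,
    ← Finset.sum_sub_distrib, Finset.mul_sum]
  rw [← Finset.sum_add_distrib, ← Finset.sum_add_distrib]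
  refine Finset.sum_congr rfl fun j _ => ?_
  linear_combination hahnCoeff α c N n j * poch_forward_diff N s x j

theorem hahn_backward_diff (α c N s x : ℝ) {n M : ℕ} (h : n < M) :
    (x - α) * ((hahn α c N n).eval x - (hahn α c N n).eval (x - 1))
        + s * (hahn α c N n).eval x
      = ∑ j ∈ Finset.range M, ((s + j) * hahnCoeff α c N n j
          + ((j : ℝ) + 1) * (α - (j + 1) - s) * hahnCoeff α c N n (j + 1))
            * poch (1 - x) j := by
  have key := sum_range_mul_pred (hahnCoeff α c N n) (fun j => α - (j : ℝ) - s)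
    (poch (1 - x)) (hahnCoeff_eq_zero α c N h)
  simp only [Nat.cast_add, Nat.cast_one] at key
  simp only [add_mul _ _ (poch (1 - x) _), Finset.sum_add_distrib, ← key, hahn_eval α c N _ h,
    ← Finset.sum_sub_distrib, Finset.mul_sum]
  rw [← Finset.sum_add_distrib, ← Finset.sum_add_distrib]
  refine Finset.sum_congr rfl fun j _ => ?_
  linear_combination hahnCoeff α c N n j * poch_backward_diff α s x j

theorem poch_neg_succ_shift (n j : ℕ) :
    ((n : ℝ) + 1 - j) * poch (-((n : ℝ) + 1)) j = (n + 1) * poch (-(n : ℝ)) j := by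
  have h := poch_succ_left (-((n : ℝ) + 1)) j
  rw [poch_succ, show -((n : ℝ) + 1) + 1 = -n by ring] at h
  linear_combination -h

section Coefficients

variable {α c N : ℝ}

/-- Below the top two degrees, four neighbouring Hahn coefficients are explicit multiples of a
common value. -/
theorem hahnCoeff_neighbours (h1 : ∀ m : ℕ, α + c - N ≠ -((m : ℝ) + 1)) {n j : ℕ} (hj : j < n) :
    ∃ t : ℝ,
      (n + 1 - j) * hahnCoeff α c N (n + 1) j
          * ((2 * (n + 1) + α + c - N - 1) * (2 * (n + 1) + α + c - N - 2))
        = (n + 1) * t * (1 - N + j) * (n + 1 - N) * (c + j) * (c + n) ∧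
      (j + 1) * hahnCoeff α c N (n + 1) (j + 1)
          * ((2 * (n + 1) + α + c - N - 1) * (2 * (n + 1) + α + c - N - 2))
        = -((n + 1) * t * (n + 1 - N) * (c + n) * (n + 1 + α + c - N + j)) ∧
      (n + α + c - N + j) * hahnCoeff α c N n j = t * (1 - N + j) * (c + j) ∧
      (j + 1) * hahnCoeff α c N n (j + 1) = t * (j - n) := by
  have hne : ∀ m : ℕ, (m : ℝ) + 1 + (α + c - N) ≠ 0 := fun m h => h1 m (by linarith)
  obtain ⟨l, rfl⟩ : ∃ l, n = j + 1 + l := ⟨n - (j + 1), by omega⟩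
  have e1 : j + 1 + l + 1 - j = l + 1 + 1 := by omega
  have e2 : j + 1 + l + 1 - (j + 1) = l + 1 := by omega
  have e3 : j + 1 + l - j = l + 1 := by omega
  have e4 : j + 1 + l - (j + 1) = l := by omega
  have hs := poch_neg_succ_shift (j + 1 + l) j
  have hs' := poch_succ_left (-((j + 1 + l : ℕ) + 1 : ℝ)) j
  rw [show -((j + 1 + l : ℕ) + 1 : ℝ) + 1 = -((j + 1 + l : ℕ) : ℝ) by ring] at hs'
  have hE : poch ((j : ℝ) + 1 + l + 1 + α + c - N + j) l ≠ 0 := poch_ne_zero fun i h =>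
    hne (j + 1 + l + j + i) (by push_cast; linarith)
  have hE2 : poch ((j : ℝ) + 1 + l + 1 + α + c - N + j) (l + 1 + 1)
      = poch ((j : ℝ) + 1 + l + 1 + α + c - N + j) l
        * (2 * ((j : ℝ) + 1 + l + 1) + α + c - N - 2)
        * (2 * ((j : ℝ) + 1 + l + 1) + α + c - N - 1) := by
    rw [poch_succ, poch_succ]
    push_cast
    ring
  have hd1 : (2 * ((j : ℝ) + 1 + l + 1) + α + c - N - 1) ≠ 0 := fun h =>
    hne (j + 1 + l + j + 1 + l) (by push_cast; linarith)
  have hd2 : (2 * ((j : ℝ) + 1 + l + 1) + α + c - N - 2) ≠ 0 := fun h =>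
    hne (j + 1 + l + j + l) (by push_cast; linarith)
  have hd3 : ((j : ℝ) + 1 + l + 1 + α + c - N + j) ≠ 0 := fun h =>
    hne (j + 1 + l + j) (by push_cast; linarith)
  have hd4 : ((j : ℝ) + 1 + l + α + c - N + j) ≠ 0 := fun h =>
    hne (j + l + j) (by push_cast; linarith)
  have hf : (j.factorial : ℝ) ≠ 0 := by exact_mod_cast j.factorial_ne_zero
  have hE4 : poch ((j : ℝ) + 1 + l + 1 + α + c - N + j + 1) (l + 1)
      = poch ((j : ℝ) + 1 + l + 1 + α + c - N + j) l
        * (2 * ((j : ℝ) + 1 + l + 1) + α + c - N - 2)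
        * (2 * ((j : ℝ) + 1 + l + 1) + α + c - N - 1)
        / ((j : ℝ) + 1 + l + 1 + α + c - N + j) := by
    rw [eq_div_iff hd3, mul_comm, ← poch_succ_left, hE2]
  refine ⟨poch (-((j + 1 + l : ℕ) : ℝ)) j * poch (1 - N + j + 1) l * poch (c + j + 1) l
    / (poch ((j : ℝ) + 1 + l + 1 + α + c - N + j) l * j.factorial), ?_, ?_, ?_, ?_⟩
  · rw [hahnCoeff, e1]
    push_cast at hs ⊢
    rw [hE2, poch_succ_left (1 - N + j), poch_succ, poch_succ_left (c + j), poch_succ (c + j + 1)]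
    generalize 2 * ((j : ℝ) + 1 + l + 1) + α + c - N - 1 = D at hd1 ⊢
    generalize 2 * ((j : ℝ) + 1 + l + 1) + α + c - N - 2 = D' at hd2 ⊢
    generalize poch ((j : ℝ) + 1 + l + 1 + α + c - N + j) l = E at hE ⊢
    generalize poch (1 - N + j + 1) l = P
    generalize poch (c + j + 1) l = Q
    generalize poch (-((j : ℝ) + 1 + l)) j = R at hs ⊢
    generalize poch (-((j : ℝ) + 1 + l + 1)) j = R' at hs ⊢
    have hc : ∀ X : ℝ, X / (E * D' * D * j.factorial) * (D * D') = X / (E * j.factorial) :=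
      fun X => by field_simp
    rw [mul_assoc _ _ (D * D'), hc]
    linear_combination (1 - N + j) * P * (1 - N + j + 1 + l) * (c + j) * Q * (c + j + 1 + l)
      / (E * j.factorial) * hs
  · rw [hahnCoeff, e2]
    push_cast [Nat.factorial_succ] at hs' ⊢
    rw [hs', ← add_assoc (1 - N), ← add_assoc c,
      ← add_assoc ((j : ℝ) + 1 + l + 1 + α + c - N), hE4, poch_succ, poch_succ]
    generalize 2 * ((j : ℝ) + 1 + l + 1) + α + c - N - 1 = D at hd1 ⊢
    generalize 2 * ((j : ℝ) + 1 + l + 1) + α + c - N - 2 = D' at hd2 ⊢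
    generalize poch ((j : ℝ) + 1 + l + 1 + α + c - N + j) l = E at hE ⊢
    generalize (j : ℝ) + 1 + l + 1 + α + c - N + j = A at hd3 ⊢
    generalize poch (1 - N + j + 1) l = P
    generalize poch (c + j + 1) l = Q
    generalize poch (-((j : ℝ) + 1 + l)) j = R
    field_simp
    ring
  · rw [hahnCoeff, e3]
    push_cast
    rw [poch_succ_left, poch_succ_left, poch_succ_left,
      show (j : ℝ) + 1 + l + α + c - N + j + 1 = j + 1 + l + 1 + α + c - N + j by ring]
    field_simp
  · rw [hahnCoeff, e4]
    push_cast [Nat.factorial_succ]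
    rw [poch_succ, ← add_assoc (1 - N), ← add_assoc c,
      show (j : ℝ) + 1 + l + α + c - N + (j + 1) = j + 1 + l + 1 + α + c - N + j by ring]
    field_simp
    ring

/-- The top Hahn coefficients, in terms of a common value. -/
theorem hahnCoeff_top (n : ℕ) (hd : 2 * ((n : ℝ) + 1) + α + c - N - 1 ≠ 0) :
      hahnCoeff α c N (n + 1) n * (2 * (n + 1) + α + c - N - 1)
        = (n + 1) * hahnCoeff α c N n n * (n + 1 - N) * (c + n) ∧
      hahnCoeff α c N (n + 1) (n + 1) = -hahnCoeff α c N n n := by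
  have hs := poch_neg_succ_shift n n
  have hs' := poch_succ_left (-((n : ℝ) + 1)) n
  rw [show -((n : ℝ) + 1) + 1 = -n by ring] at hs'
  have hf : (n.factorial : ℝ) ≠ 0 := by exact_mod_cast n.factorial_ne_zero
  constructor
  · simp only [hahnCoeff, Nat.add_sub_cancel_left, Nat.sub_self, poch_succ, poch_zero,
      Nat.cast_add, Nat.cast_one, Nat.cast_zero]
    rw [show (n : ℝ) + 1 + α + c - N + n = 2 * (n + 1) + α + c - N - 1 by ring]
    generalize 2 * ((n : ℝ) + 1) + α + c - N - 1 = D at hd ⊢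
    simp only [add_zero, one_mul]
    field_simp
    linear_combination (1 - N + n) * (c + n) * hs
  · simp only [hahnCoeff, Nat.sub_self, poch_zero, Nat.factorial_succ, Nat.cast_mul,
      Nat.cast_add, Nat.cast_one, hs']
    field_simp

theorem hahnCoeff_forward (h1 : ∀ m : ℕ, α + c - N ≠ -((m : ℝ) + 1)) (n j : ℕ)
    (hd1 : 2 * ((n : ℝ) + 1) + α + c - N - 1 ≠ 0) (hd2 : 2 * ((n : ℝ) + 1) + α + c - N - 2 ≠ 0) :
    (n + 1 - j) * hahnCoeff α c N (n + 1) j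
        + (j + 1) * (j + 1 - N) * hahnCoeff α c N (n + 1) (j + 1)
      = -((n + 1) * (N - (n + 1)) * (n + 1 + α - N)
          / ((2 * ((n : ℝ) + 1) + α + c - N - 1) * (2 * ((n : ℝ) + 1) + α + c - N - 2)))
        * ((-(n + α + c - N) - j) * hahnCoeff α c N n j
          + (j + 1) * (j + 1 - N) * hahnCoeff α c N n (j + 1)) := by
  rcases lt_trichotomy j n with hj | rfl | hj
  · obtain ⟨t, a1, a2, a3, a4⟩ := hahnCoeff_neighbours h1 hj
    rw [← mul_left_inj' (mul_ne_zero hd1 hd2), neg_mul, neg_mul, div_mul_eq_mul_div,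
      div_mul_cancel₀ _ (mul_ne_zero hd1 hd2)]
    linear_combination a1 + (j + 1 - N) * a2
      - (n + 1) * (N - (n + 1)) * (n + 1 + α - N) * (a3 - (j + 1 - N) * a4)
  · obtain ⟨a1, a2⟩ := hahnCoeff_top j hd1
    rw [hahnCoeff_eq_zero α c N (Nat.lt_succ_self j), a2]
    rw [← mul_left_inj' (mul_ne_zero hd1 hd2), neg_mul, neg_mul, div_mul_eq_mul_div,
      div_mul_cancel₀ _ (mul_ne_zero hd1 hd2)]
    linear_combination (2 * ((j : ℝ) + 1) + α + c - N - 2) * a1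
  · rw [hahnCoeff_eq_zero α c N hj, hahnCoeff_eq_zero α c N (Nat.lt_succ_of_lt hj),
      hahnCoeff_eq_zero α c N (Nat.succ_lt_succ hj)]
    rcases (Nat.succ_le_of_lt hj).eq_or_lt with rfl | hj'
    · simp
    · simp [hahnCoeff_eq_zero α c N hj']

theorem hahnCoeff_backward (h1 : ∀ m : ℕ, α + c - N ≠ -((m : ℝ) + 1)) (n j : ℕ)
    (hd1 : 2 * ((n : ℝ) + 1) + α + c - N - 1 ≠ 0) (hd2 : 2 * ((n : ℝ) + 1) + α + c - N - 2 ≠ 0) :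
    (-(n + 1) + j) * hahnCoeff α c N (n + 1) j
        + (j + 1) * (α - (j + 1) - -(n + 1)) * hahnCoeff α c N (n + 1) (j + 1)
      = -((n + 1) * (n + 1 + α - N) * (n + 1 + α + c - 1)
          / ((2 * ((n : ℝ) + 1) + α + c - N - 1) * (2 * ((n : ℝ) + 1) + α + c - N - 2)))
        * ((n + α + c - N + j) * hahnCoeff α c N n j
          + (j + 1) * (α - (j + 1) - (n + α + c - N)) * hahnCoeff α c N n (j + 1)) := by
  rcases lt_trichotomy j n with hj | rfl | hj
  · obtain ⟨t, a1, a2, a3, a4⟩ := hahnCoeff_neighbours h1 hj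
    rw [← mul_left_inj' (mul_ne_zero hd1 hd2), neg_mul, neg_mul, div_mul_eq_mul_div,
      div_mul_cancel₀ _ (mul_ne_zero hd1 hd2)]
    linear_combination -a1 + (α - (j + 1) + (n + 1)) * a2
      + (n + 1) * (n + 1 + α - N) * (n + 1 + α + c - 1)
        * (a3 + (α - (j + 1) - (n + α + c - N)) * a4)
  · obtain ⟨a1, a2⟩ := hahnCoeff_top j hd1
    rw [hahnCoeff_eq_zero α c N (Nat.lt_succ_self j), a2]
    rw [← mul_left_inj' (mul_ne_zero hd1 hd2), neg_mul, neg_mul, div_mul_eq_mul_div,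
      div_mul_cancel₀ _ (mul_ne_zero hd1 hd2)]
    linear_combination -(2 * ((j : ℝ) + 1) + α + c - N - 2) * a1
  · rw [hahnCoeff_eq_zero α c N hj, hahnCoeff_eq_zero α c N (Nat.lt_succ_of_lt hj),
      hahnCoeff_eq_zero α c N (Nat.succ_lt_succ hj)]
    rcases (Nat.succ_le_of_lt hj).eq_or_lt with rfl | hj'
    · simp
    · simp [hahnCoeff_eq_zero α c N hj']

end Coefficients

/-- An alternating sum of products solves its first-order recurrence. -/
theorem alternating_sum_eq_of_recurrence (σ ε h T : ℕ → ℝ) (h0 : T 0 = 0)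
    (hT : ∀ n, T (n + 1) = ε (n + 1) * (σ (n + 1) * h n - T n)) (n : ℕ) :
    ∑ j ∈ Finset.Icc 1 n, (-1 : ℝ) ^ (j + 1) * σ (n + 1 - j)
      * (∏ i ∈ Finset.range j, ε (n - i)) * h (n - j) = T n := by
  have hsum : ∀ (f : ℕ → ℝ) (n : ℕ),
      ∑ j ∈ Finset.Icc 1 n, f j = ∑ j ∈ Finset.range n, f (j + 1) := fun f n => by
    rw [Finset.range_eq_Ico, Finset.sum_Ico_add' f 0 n 1]
    rfl
  rw [hsum]
  induction n with
  | zero => simp [h0]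
  | succ n ih =>
    rw [Finset.sum_range_succ', hT, ← ih, mul_sub, Finset.mul_sum, sub_eq_neg_add,
      ← Finset.sum_neg_distrib]
    congr 1
    · refine Finset.sum_congr rfl fun j _ => ?_
      rw [Finset.prod_range_succ']
      simp only [Nat.add_sub_add_right, Nat.sub_zero]
      ring
    · simp
      ring

/-- Lemma 7.2 (first two 𝒟-operators of type 2 for the Hahn family). -/
theorem stmt15 (α c N : ℝ)
    (h1 : ∀ m : ℕ, α + c - N ≠ -((m : ℝ) + 1))
    (h2 : ∀ m : ℕ, 1 ≤ m → 2*(m : ℝ) + α + c - N - 1 ≠ 0)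
    (h3 : ∀ m : ℕ, 1 ≤ m → 2*(m : ℝ) + α + c - N - 2 ≠ 0)
    (σ ε ε' : ℕ → ℝ)
    (hσ : ∀ m : ℕ, 1 ≤ m → σ m = 2*(m : ℝ) + α + c - N - 2)
    (hε : ∀ m : ℕ, 1 ≤ m → ε m =
      (m : ℝ)*(N - m)*((m : ℝ) + α - N)
        / ((2*(m : ℝ) + α + c - N - 1)*(2*(m : ℝ) + α + c - N - 2)))
    (hε' : ∀ m : ℕ, 1 ≤ m → ε' m =
      (m : ℝ)*((m : ℝ) + α - N)*((m : ℝ) + α + c - 1)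
        / ((2*(m : ℝ) + α + c - N - 1)*(2*(m : ℝ) + α + c - N - 2))) :
    ∀ n : ℕ, ∀ x : ℝ,
      (-(σ (n+1)) / 2 * (hahn α c N n).eval x
          + ∑ j ∈ Finset.Icc 1 n, (-1:ℝ)^(j+1) * σ (n+1-j)
              * (∏ i ∈ Finset.range j, ε (n - i)) * (hahn α c N (n-j)).eval x
        = (-x + N - 1) * ((hahn α c N n).eval (x+1) - (hahn α c N n).eval x)
            - (α + c - N)/2 * (hahn α c N n).eval x) ∧
      ((σ (n+1)) / 2 * (hahn α c N n).eval x
          + ∑ j ∈ Finset.Icc 1 n, (-1:ℝ)^(j+1) * (-(σ (n+1-j)))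
              * (∏ i ∈ Finset.range j, ε' (n - i)) * (hahn α c N (n-j)).eval x
        = (x - α) * ((hahn α c N n).eval x - (hahn α c N n).eval (x-1))
            + (α + c - N)/2 * (hahn α c N n).eval x) := by
  intro n x
  constructor
  · have key := alternating_sum_eq_of_recurrence σ ε (fun n => (hahn α c N n).eval x)
      (fun n => (-x + N - 1) * ((hahn α c N n).eval (x + 1) - (hahn α c N n).eval x)
        + n * (hahn α c N n).eval x) (by simp [hahn_zero_eval]) (fun n => ?_) n
    · rw [key, hσ (n + 1) (by omega)]
      push_cast
      ring
    · have hd1 := h2 (n + 1) (by omega)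
      have hd2 := h3 (n + 1) (by omega)
      have hε1 := hε (n + 1) (by omega)
      have hσ1 := hσ (n + 1) (by omega)
      push_cast at hd1 hd2 hε1 hσ1
      have A := hahn_forward_diff α c N (n + 1) x (Nat.lt_succ_self (n + 1))
      have B := hahn_forward_diff α c N (-(n + α + c - N)) x
        (Nat.lt_succ_of_lt (Nat.lt_succ_self n))
      simp only [hahnCoeff_forward h1 n _ hd1 hd2, ← hε1, mul_assoc (-ε (n + 1)),
        ← Finset.mul_sum] at A
      rw [Nat.succ_eq_add_one] at A B
      rw [← B] at A
      push_cast
      rw [A, hσ1]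
      ring
  · have key := alternating_sum_eq_of_recurrence (fun m => -σ m) ε'
      (fun n => (hahn α c N n).eval x)
      (fun n => (x - α) * ((hahn α c N n).eval x - (hahn α c N n).eval (x - 1))
        + -n * (hahn α c N n).eval x) (by simp [hahn_zero_eval]) (fun n => ?_) n
    · rw [key, hσ (n + 1) (by omega)]
      push_cast
      ring
    · have hd1 := h2 (n + 1) (by omega)
      have hd2 := h3 (n + 1) (by omega)
      have hε1 := hε' (n + 1) (by omega)
      have hσ1 := hσ (n + 1) (by omega)
      push_cast at hd1 hd2 hε1 hσ1
      have A := hahn_backward_diff α c N (-(n + 1)) x (Nat.lt_succ_self (n + 1))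
      have B := hahn_backward_diff α c N (n + α + c - N) x
        (Nat.lt_succ_of_lt (Nat.lt_succ_self n))
      simp only [hahnCoeff_backward h1 n _ hd1 hd2, ← hε1, mul_assoc (-ε' (n + 1)),
        ← Finset.mul_sum] at A
      rw [Nat.succ_eq_add_one] at A B
      rw [← B] at A
      push_cast
      rw [A, hσ1]
      ring
end
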